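/- The cut-and-join operator Δ := (1/2) Σ_{i,j≥1} [ (i+j) T_i T_j ∂/∂T_{i+j} + i j T_{i+j} ∂²/(∂T_i ∂T_j) ], a well-defined linear operator on ℂ[T_1,T_2,…] (only finitely many terms act nontrivially on any fixed polynomial), has every Schur polynomial as an eigenvector: for every partition λ, Δ s_λ(T) = ( Σ_{(i,j)∈λ} (j−i) ) · s_λ(T), the eigenvalue being the sum of the contents of the cells of the Young diagram of λ. -/

import Mathlib

open MvPolynomial

/-- A partition `λ = (λ_1, λ_2, …)`: a non-increasing sequence of non-negative
integers with finitely many nonzero parts.  `parts i` is the part `λ_{i+1}`. -/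
structure Ptn where
  parts : ℕ → ℕ
  antitone : ∀ ⦃i j : ℕ⦄, i ≤ j → parts j ≤ parts i
  eventually_zero : ∃ N : ℕ, ∀ i : ℕ, N ≤ i → parts i = 0

/-- The length `ℓ(λ)`: the number of nonzero parts. -/
noncomputable def Ptn.len (lam : Ptn) : ℕ := Set.ncard {i : ℕ | lam.parts i ≠ 0}

/-- The generating series `Σ_{k≥1} T_k z^k / k` (with `T_k = X k`). -/
noncomputable def genT : PowerSeries (MvPolynomial ℕ+ ℂ) :=
  PowerSeries.mk fun m =>
    if h : m = 0 then 0 else ((m : ℂ)⁻¹) • (X (⟨m, Nat.pos_of_ne_zero h⟩ : ℕ+))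

/-- The complete homogeneous polynomial `h_k(T)`, defined via
`Σ_{k≥0} h_k(T) z^k = exp(Σ_{k≥1} T_k z^k / k)`: the coefficient of `z^k` in
`exp(genT) = Σ_n genT^n / n!` (only `n ≤ k` contributes). -/
noncomputable def hsym (k : ℕ) : MvPolynomial ℕ+ ℂ :=
  ∑ n ∈ Finset.range (k + 1),
    ((Nat.factorial n : ℂ)⁻¹) • (PowerSeries.coeff (R := MvPolynomial ℕ+ ℂ) k (genT ^ n))

/-- `h_k` for an integer index, with `h_k := 0` for `k < 0`. -/
noncomputable def hsymZ (z : ℤ) : MvPolynomial ℕ+ ℂ :=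
  if 0 ≤ z then hsym z.toNat else 0

/-- The Schur polynomial `s_λ = det(h_{λ_i−i+j})_{1≤i,j≤ℓ(λ)}` (Jacobi–Trudi). -/
noncomputable def schur (lam : Ptn) : MvPolynomial ℕ+ ℂ :=
  (Matrix.of fun i j : Fin lam.len =>
    hsymZ ((lam.parts i : ℤ) - ((i : ℕ) + 1) + ((j : ℕ) + 1))).det

/-- The cut-and-join operator
`Δ = (1/2) Σ_{i,j≥1} [(i+j) T_i T_j ∂/∂T_{i+j} + i j T_{i+j} ∂²/(∂T_i ∂T_j)]`;
on any fixed polynomial only finitely many terms act nontrivially. -/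
noncomputable def cutJoin (f : MvPolynomial ℕ+ ℂ) : MvPolynomial ℕ+ ℂ :=
  (2 : ℂ)⁻¹ • ∑ᶠ p : ℕ+ × ℕ+,
    ((((p.1 + p.2 : ℕ+) : ℕ) : ℂ) • (X p.1 * X p.2 * pderiv (p.1 + p.2) f) +
     (((p.1 : ℕ) : ℂ) * ((p.2 : ℕ) : ℂ)) • (X (p.1 + p.2) * pderiv p.1 (pderiv p.2 f)))


noncomputable def TT (n : ℕ) : MvPolynomial ℕ+ ℂ := X n.succPNat

noncomputable def DD (i : ℕ) : Derivation ℂ (MvPolynomial ℕ+ ℂ) (MvPolynomial ℕ+ ℂ) :=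
  ((i : ℂ) + 1) • pderiv i.succPNat

lemma coeff_succ_genT (m : ℕ) :
    PowerSeries.coeff (m + 1) genT = (((m : ℂ) + 1)⁻¹) • TT m := by
  simp only [genT, PowerSeries.coeff_mk, TT]
  rw [dif_neg (Nat.succ_ne_zero m)]
  push_cast
  rfl

lemma coeff_zero_genT : PowerSeries.coeff 0 genT = 0 := by
  simp [genT]

lemma coeff_genT_pow_eq_zero {k n : ℕ} (h : k < n) : PowerSeries.coeff k (genT ^ n) = 0 := by
  have h1 : (PowerSeries.X : PowerSeries (MvPolynomial ℕ+ ℂ)) ∣ genT := by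
    rw [PowerSeries.X_dvd_iff, ← PowerSeries.coeff_zero_eq_constantCoeff_apply]
    exact coeff_zero_genT
  exact PowerSeries.X_pow_dvd_iff.1 (pow_dvd_pow_of_dvd h1 n) k h

lemma hsym_eq (k M : ℕ) (h : k < M) : hsym k = ∑ n ∈ Finset.range M,
    ((Nat.factorial n : ℂ)⁻¹) • (PowerSeries.coeff (R := MvPolynomial ℕ+ ℂ) k (genT ^ n)) := by
  unfold hsym
  apply Finset.sum_subset
  · intro x hx
    simp at hx ⊢
    omega
  · intro x _ hx
    simp at hx
    rw [coeff_genT_pow_eq_zero (by omega), smul_zero]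

noncomputable def cD (i : ℕ) (f : PowerSeries (MvPolynomial ℕ+ ℂ)) :
    PowerSeries (MvPolynomial ℕ+ ℂ) := PowerSeries.mk fun k => DD i (PowerSeries.coeff k f)

lemma cD_mul (i : ℕ) (f g : PowerSeries (MvPolynomial ℕ+ ℂ)) :
    cD i (f * g) = cD i f * g + f * cD i g := by
  ext1 k
  simp only [cD, PowerSeries.coeff_mk, PowerSeries.coeff_mul, map_add, map_sum,
    Derivation.leibniz, smul_eq_mul, Finset.sum_add_distrib]
  rw [add_comm]
  congr 1
  exact Finset.sum_congr rfl fun _ _ => mul_comm _ _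

lemma cD_genT (i : ℕ) : cD i genT = PowerSeries.X ^ (i + 1) := by
  ext1 k
  simp only [cD, PowerSeries.coeff_mk, PowerSeries.coeff_X_pow]
  cases k with
  | zero => simp [coeff_zero_genT]
  | succ m =>
    rw [coeff_succ_genT, Derivation.map_smul]
    simp only [DD, TT, Derivation.smul_apply, pderiv_X, Pi.single_apply]
    by_cases h : m = i
    · subst h
      have : (m : ℂ) + 1 ≠ 0 := by exact_mod_cast Nat.succ_ne_zero m
      simp [smul_smul, this]
    · have h2 : i.succPNat ≠ m.succPNat := fun h' => h (Nat.succPNat_injective h').symm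
      simp [h, h2.symm]

lemma cD_pow (i n : ℕ) : cD i (genT ^ (n + 1)) =
    ((n : MvPolynomial ℕ+ ℂ) + 1) • (PowerSeries.X ^ (i + 1) * genT ^ n) := by
  induction n with
  | zero => simp [cD_genT]
  | succ n ih =>
    rw [pow_succ, cD_mul, ih, cD_genT]
    simp only [PowerSeries.smul_eq_C_mul, map_add, map_one, Nat.cast_succ]
    ring

lemma fact_aux (n : ℕ) (x : MvPolynomial ℕ+ ℂ) :
    ((Nat.factorial (n + 1) : ℂ)⁻¹) • (((n : MvPolynomial ℕ+ ℂ) + 1) * x)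
      = ((Nat.factorial n : ℂ)⁻¹) • x := by
  have h1 : ((n : MvPolynomial ℕ+ ℂ) + 1) * x = ((n : ℂ) + 1) • x := by
    rw [MvPolynomial.smul_eq_C_mul]; simp
  rw [h1, smul_smul]
  congr 1
  have : (n : ℂ) + 1 ≠ 0 := by exact_mod_cast Nat.succ_ne_zero n
  rw [Nat.factorial_succ]; push_cast
  field_simp

lemma DD_hsym (i k : ℕ) : DD i (hsym k) = if i + 1 ≤ k then hsym (k - (i + 1)) else 0 := by
  have key : ∀ n : ℕ, DD i (PowerSeries.coeff k (genT ^ (n + 1))) =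
      ((n : MvPolynomial ℕ+ ℂ) + 1) *
        (if i + 1 ≤ k then PowerSeries.coeff (k - (i + 1)) (genT ^ n) else 0) := by
    intro n
    have := congrArg (PowerSeries.coeff k) (cD_pow i n)
    rw [PowerSeries.coeff_smul, PowerSeries.coeff_X_pow_mul'] at this
    simpa [cD] using this
  unfold hsym
  rw [map_sum, Finset.sum_range_succ']
  simp only [Derivation.map_smul, key, fact_aux]
  have h0 : DD i (PowerSeries.coeff k (genT ^ 0)) = 0 := by
    rw [pow_zero, PowerSeries.coeff_one]
    split_ifs <;> simp
  rw [h0, smul_zero, add_zero]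
  split_ifs with h
  · rw [← hsym_eq (k - (i + 1)) k (by omega)]
    rfl
  · simp

lemma hsym_rec (k : ℕ) : ((k : ℂ) + 1) • hsym (k + 1) =
    ∑ i ∈ Finset.range (k + 1), TT i * hsym (k - i) := by
  have key : ∀ n : ℕ, ((k : ℂ) + 1) • (PowerSeries.coeff (k + 1) (genT ^ (n + 1))) =
      ((n : MvPolynomial ℕ+ ℂ) + 1) *
        ∑ i ∈ Finset.range (k + 1), TT i * PowerSeries.coeff (k - i) (genT ^ n) := by
    intro n
    have h := congrArg (PowerSeries.coeff k)
      (PowerSeries.derivative_pow (R := MvPolynomial ℕ+ ℂ) genT (n + 1))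
    have hd : ∀ i, PowerSeries.coeff i (PowerSeries.derivative (MvPolynomial ℕ+ ℂ) genT) = TT i := by
      intro i
      rw [PowerSeries.coeff_derivative, coeff_succ_genT]
      have : (i : ℂ) + 1 ≠ 0 := by exact_mod_cast Nat.succ_ne_zero i
      rw [show ((i : MvPolynomial ℕ+ ℂ) + 1) = C ((i : ℂ) + 1) by simp, mul_comm,
        ← MvPolynomial.smul_eq_C_mul, smul_smul, mul_inv_cancel₀ this, one_smul]
    rw [PowerSeries.coeff_derivative] at h
    rw [MvPolynomial.smul_eq_C_mul, map_add, map_natCast, map_one, mul_comm, h]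
    rw [Nat.add_sub_cancel, mul_assoc, mul_comm (genT ^ n),
      show (((n + 1 : ℕ) : PowerSeries (MvPolynomial ℕ+ ℂ)))
        = PowerSeries.C ((n : MvPolynomial ℕ+ ℂ) + 1) by simp,
      PowerSeries.coeff_C_mul, PowerSeries.coeff_mul,
      Finset.Nat.sum_antidiagonal_eq_sum_range_succ_mk]
    simp only [hd]
  unfold hsym
  rw [Finset.smul_sum, Finset.sum_range_succ']
  have h0 : PowerSeries.coeff (k + 1) (genT ^ 0) = 0 := by
    rw [pow_zero, PowerSeries.coeff_one]; simp
  rw [h0, smul_zero, smul_zero, add_zero]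
  simp_rw [smul_comm ((k : ℂ) + 1), key, fact_aux]
  simp_rw [Finset.smul_sum]
  rw [Finset.sum_comm]
  refine Finset.sum_congr rfl fun i hi => ?_
  change _ = TT i * hsym (k - i)
  rw [hsym_eq (k - i) (k + 1) (by omega), Finset.mul_sum]
  exact Finset.sum_congr rfl fun _ _ => (mul_smul_comm _ _ _).symm

lemma DD_hsymZ (i : ℕ) (k : ℤ) : DD i (hsymZ k) = hsymZ (k - (i + 1)) := by
  unfold hsymZ
  by_cases h : 0 ≤ k
  · lift k to ℕ using h
    simp only [Int.natCast_nonneg, if_true, Int.toNat_natCast, DD_hsym]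
    by_cases h : i + 1 ≤ k
    · rw [if_pos h, if_pos (by omega)]; congr 1; omega
    · rw [if_neg h, if_neg (by omega)]
  · rw [if_neg h, if_neg (by omega), map_zero]

lemma hsymZ_neg {k : ℤ} (h : k < 0) : hsymZ k = 0 := if_neg (by omega)

lemma hsymZ_rec (k : ℤ) (N : ℕ) (hN : k ≤ N) : (k : ℂ) • hsymZ k =
    ∑ i ∈ Finset.range N, TT i * hsymZ (k - (i + 1)) := by
  by_cases h : 0 < k
  · obtain ⟨m, rfl⟩ : ∃ m : ℕ, k = m + 1 := ⟨(k - 1).toNat, by omega⟩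
    have h1 : hsymZ ((m : ℤ) + 1) = hsym (m + 1) := by
      unfold hsymZ; rw [if_pos (by omega)]; congr 1
    rw [h1]; push_cast
    rw [hsym_rec]
    have hs : Finset.range (m + 1) ⊆ Finset.range N := by
      intro x hx; simp at hx ⊢; omega
    rw [← Finset.sum_subset hs]
    · refine Finset.sum_congr rfl fun i hi => ?_
      simp at hi
      congr 1
      unfold hsymZ; rw [if_pos (by omega)]; congr 1; omega
    · intro x _ hx
      simp at hx
      rw [hsymZ_neg (by omega), mul_zero]
  · have : (k : ℂ) • hsymZ k = 0 := by
      rcases eq_or_lt_of_le (not_lt.1 h) with h | h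
      · simp [h]
      · rw [hsymZ_neg h, smul_zero]
    rw [this, Finset.sum_eq_zero]
    intro i _
    rw [hsymZ_neg (by omega), mul_zero]

noncomputable def cutN (N : ℕ) (f : MvPolynomial ℕ+ ℂ) : MvPolynomial ℕ+ ℂ :=
  ∑ i ∈ Finset.range N, ∑ j ∈ Finset.range N,
    (TT i * TT j * DD (i + j + 1) f + TT (i + j + 1) * DD i (DD j f))

noncomputable def BB (N : ℕ) (f g : MvPolynomial ℕ+ ℂ) : MvPolynomial ℕ+ ℂ :=
  ∑ i ∈ Finset.range N, ∑ j ∈ Finset.range N, TT (i + j + 1) * (DD i f * DD j g)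

lemma BB_symm (N : ℕ) (f g : MvPolynomial ℕ+ ℂ) : BB N f g = BB N g f := by
  unfold BB
  rw [Finset.sum_comm]
  refine Finset.sum_congr rfl fun i _ => Finset.sum_congr rfl fun j _ => ?_
  rw [mul_comm (DD j f), add_comm j i]

lemma cutN_add (N : ℕ) (f g : MvPolynomial ℕ+ ℂ) : cutN N (f + g) = cutN N f + cutN N g := by
  simp only [cutN, map_add, mul_add, ← Finset.sum_add_distrib]
  refine Finset.sum_congr rfl fun i _ => Finset.sum_congr rfl fun j _ => ?_
  ring

lemma cutN_smul (N : ℕ) (c : ℂ) (f : MvPolynomial ℕ+ ℂ) : cutN N (c • f) = c • cutN N f := by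
  simp only [cutN, Derivation.map_smul, mul_smul_comm, Finset.smul_sum, smul_add]

def eP : ℕ × ℕ ↪ ℕ+ × ℕ+ := ⟨fun p => (p.1.succPNat, p.2.succPNat), fun a b h => by
    simp only [Prod.mk.injEq] at h
    exact Prod.ext (Nat.succPNat_injective h.1) (Nat.succPNat_injective h.2)⟩

lemma eP_apply (p : ℕ × ℕ) : eP p = (p.1.succPNat, p.2.succPNat) := rfl

lemma cutJoin_eventually (f : MvPolynomial ℕ+ ℂ) :
    ∀ᶠ N in Filter.atTop, cutJoin f = (2 : ℂ)⁻¹ • cutN N f := by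
  set F : ℕ+ × ℕ+ → MvPolynomial ℕ+ ℂ := fun p =>
    ((((p.1 + p.2 : ℕ+) : ℕ) : ℂ) • (X p.1 * X p.2 * pderiv (p.1 + p.2) f) +
     (((p.1 : ℕ) : ℂ) * ((p.2 : ℕ) : ℂ)) • (X (p.1 + p.2) * pderiv p.1 (pderiv p.2 f))) with hF
  let M : ℕ := (∑ v ∈ f.vars, (v : ℕ)) + ∑ v ∈ f.vars, ∑ u ∈ (pderiv v f).vars, (u : ℕ)
  filter_upwards [Filter.eventually_ge_atTop M] with N hN
  have hM1 : ∀ v ∈ f.vars, (v : ℕ) ≤ N := fun v hv => by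
    have := Finset.single_le_sum (f := fun v : ℕ+ => (v : ℕ)) (fun _ _ => Nat.zero_le _) hv
    omega
  have hM2 : ∀ v ∈ f.vars, ∀ u ∈ (pderiv v f).vars, (u : ℕ) ≤ N := fun v hv u hu => by
    have h1 := Finset.single_le_sum (f := fun v : ℕ+ => (v : ℕ)) (fun _ _ => Nat.zero_le _) hu
    have h2 := Finset.single_le_sum
      (f := fun v : ℕ+ => ∑ u ∈ (pderiv v f).vars, (u : ℕ)) (fun _ _ => Nat.zero_le _) hv
    omega
  have hsub : Function.support F ⊆
      ((Finset.range N ×ˢ Finset.range N).map eP : Finset (ℕ+ × ℕ+)) := by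
    intro p hp
    have hb : (p.1 : ℕ) ≤ N ∧ (p.2 : ℕ) ≤ N := by
      by_contra hcon
      apply hp
      have h1 : pderiv (p.1 + p.2) f = 0 := by
        apply pderiv_eq_zero_of_notMem_vars
        intro h
        have := hM1 _ h
        rw [PNat.add_coe] at this
        omega
      have h2 : pderiv p.1 (pderiv p.2 f) = 0 := by
        by_cases hv : p.2 ∈ f.vars
        · apply pderiv_eq_zero_of_notMem_vars
          intro h
          exact hcon ⟨hM2 _ hv _ h, hM1 _ hv⟩
        · rw [pderiv_eq_zero_of_notMem_vars hv, map_zero]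
      simp [hF, h1, h2]
    simp only [Finset.coe_map, Set.mem_image, Finset.mem_coe, Finset.mem_product, Finset.mem_range]
    refine ⟨(p.1.natPred, p.2.natPred), ⟨?_, ?_⟩, ?_⟩
    · have := p.1.natPred_add_one; simp only; omega
    · have := p.2.natPred_add_one; simp only; omega
    · simp [eP_apply]
  unfold cutJoin
  rw [finsum_eq_sum_of_support_subset F hsub, Finset.sum_map, Finset.sum_product]
  congr 1
  refine Finset.sum_congr rfl fun i _ => Finset.sum_congr rfl fun j _ => ?_
  have hij : i.succPNat + j.succPNat = (i + j + 1).succPNat := by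
    apply PNat.eq; simp; omega
  simp only [hF, eP_apply, hij, DD, TT, Derivation.smul_apply,
    Derivation.map_smul, mul_smul_comm, smul_smul, Nat.succPNat_coe]
  push_cast
  rw [mul_comm ((i : ℂ) + 1)]

lemma derivation_prod {ι : Type*} [DecidableEq ι] {A : Type*} [CommRing A] [Algebra ℂ A]
    (D : Derivation ℂ A A) (s : Finset ι) (f : ι → A) :
    D (∏ a ∈ s, f a) = ∑ a ∈ s, (∏ b ∈ s.erase a, f b) * D (f a) := by
  induction s using Finset.induction_on with
  | empty => simp
  | insert x s hx ih =>
    rw [Finset.prod_insert hx, Derivation.leibniz, ih, Finset.sum_insert hx,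
      Finset.erase_insert hx, smul_eq_mul, smul_eq_mul, Finset.mul_sum, add_comm]
    congr 1
    refine Finset.sum_congr rfl fun a ha => ?_
    have hne : x ≠ a := fun h => hx (h ▸ ha)
    rw [Finset.erase_insert_of_ne hne, Finset.prod_insert (by simp [hx]), mul_assoc]

lemma sum_rot {ι M : Type*} [AddCommMonoid M] (r t : Finset ℕ) (s : Finset ι) (G : ℕ → ℕ → ι → M) :
    ∑ i ∈ r, ∑ j ∈ t, ∑ a ∈ s, G i j a = ∑ a ∈ s, ∑ i ∈ r, ∑ j ∈ t, G i j a := by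
  rw [Finset.sum_comm (s := s)]
  exact Finset.sum_congr rfl fun i _ => Finset.sum_comm

lemma cutN_prod {ι : Type*} [DecidableEq ι] (N : ℕ) (s : Finset ι)
    (f : ι → MvPolynomial ℕ+ ℂ) :
    cutN N (∏ a ∈ s, f a) = ∑ a ∈ s, (∏ b ∈ s.erase a, f b) * cutN N (f a) +
      ∑ a ∈ s, ∑ b ∈ s.erase a, (∏ c ∈ (s.erase a).erase b, f c) * BB N (f b) (f a) := by
  have key : ∀ i j : ℕ, TT i * TT j * DD (i + j + 1) (∏ a ∈ s, f a)
        + TT (i + j + 1) * DD i (DD j (∏ a ∈ s, f a)) =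
      ∑ a ∈ s, (∏ b ∈ s.erase a, f b) *
        (TT i * TT j * DD (i + j + 1) (f a) + TT (i + j + 1) * DD i (DD j (f a))) +
      ∑ a ∈ s, ∑ b ∈ s.erase a, (∏ c ∈ (s.erase a).erase b, f c) *
        (TT (i + j + 1) * (DD i (f b) * DD j (f a))) := by
    intro i j
    rw [derivation_prod, derivation_prod, map_sum, Finset.mul_sum, Finset.mul_sum,
      ← Finset.sum_add_distrib, ← Finset.sum_add_distrib]
    refine Finset.sum_congr rfl fun a _ => ?_
    rw [Derivation.leibniz, derivation_prod, smul_eq_mul, smul_eq_mul, Finset.mul_sum]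
    have : ∑ b ∈ s.erase a, (∏ c ∈ (s.erase a).erase b, f c) *
        (TT (i + j + 1) * (DD i (f b) * DD j (f a))) = TT (i + j + 1) *
        ∑ b ∈ s.erase a, DD j (f a) * ((∏ c ∈ (s.erase a).erase b, f c) * DD i (f b)) := by
      rw [Finset.mul_sum]
      exact Finset.sum_congr rfl fun b _ => by ring
    rw [this]
    ring
  unfold cutN
  simp only [key]
  simp only [Finset.sum_add_distrib (s := Finset.range N)]
  rw [sum_rot, sum_rot]
  unfold BB
  refine congrArg₂ (· + ·) ?_ ?_
  · refine Finset.sum_congr rfl fun a _ => ?_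
    simp only [← Finset.sum_add_distrib]
    simp only [Finset.mul_sum]
  · refine Finset.sum_congr rfl fun a _ => ?_
    rw [sum_rot]
    refine Finset.sum_congr rfl fun b _ => ?_
    simp only [Finset.mul_sum]

lemma cutN_hsymZ (N : ℕ) (k : ℤ) (hk : k ≤ N) :
    cutN N (hsymZ k) = ((k : ℂ) * (k - 1)) • hsymZ k := by
  have h1 : ∑ i ∈ Finset.range N, ∑ j ∈ Finset.range N, TT i * TT j * DD (i + j + 1) (hsymZ k)
      = ∑ i ∈ Finset.range N, ((k : ℂ) - (i + 1)) • (TT i * hsymZ (k - (i + 1))) := by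
    refine Finset.sum_congr rfl fun i _ => ?_
    have := hsymZ_rec (k - (i + 1)) N (by omega)
    push_cast at this
    rw [← mul_smul_comm, this, Finset.mul_sum]
    refine Finset.sum_congr rfl fun j _ => ?_
    rw [DD_hsymZ, mul_assoc]
    congr 3
    push_cast; ring
  have h2 : ∑ i ∈ Finset.range N, ∑ j ∈ Finset.range N, TT (i + j + 1) * DD i (DD j (hsymZ k))
      = ∑ n ∈ Finset.range N, (n : ℂ) • (TT n * hsymZ (k - (n + 1))) := by
    have : ∀ i ∈ Finset.range N,
        ∑ j ∈ Finset.range N, TT (i + j + 1) * DD i (DD j (hsymZ k)) =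
        ∑ n ∈ Finset.range N, if i < n then TT n * hsymZ (k - (n + 1)) else 0 := by
      intro i _
      rw [← Finset.sum_filter]
      symm
      have hs : (Finset.range N).filter (i < ·) ⊆ (Finset.range N).image (fun j => i + j + 1) := by
        intro n hn
        simp only [Finset.mem_filter, Finset.mem_range, Finset.mem_image] at hn ⊢
        exact ⟨n - (i + 1), by omega, by omega⟩
      rw [Finset.sum_subset hs, Finset.sum_image]
      · refine Finset.sum_congr rfl fun j _ => ?_
        rw [DD_hsymZ, DD_hsymZ]
        congr 2
        push_cast; ring
      · intro a _ b _ h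
        simp only at h
        omega
      · intro n hn hn2
        simp only [Finset.mem_filter, Finset.mem_range, Finset.mem_image] at hn hn2
        rw [hsymZ_neg (by omega), mul_zero]
    rw [Finset.sum_congr rfl this, Finset.sum_comm]
    refine Finset.sum_congr rfl fun n hn => ?_
    rw [← Finset.sum_filter, Finset.sum_const, ← Nat.cast_smul_eq_nsmul ℂ]
    congr 2
    have : (Finset.range N).filter (· < n) = Finset.range n := by
      ext x; simp at hn ⊢; omega
    rw [this, Finset.card_range]
  unfold cutN
  simp only [Finset.sum_add_distrib]
  rw [h1, h2, ← Finset.sum_add_distrib, mul_comm, mul_smul, hsymZ_rec k N hk, Finset.smul_sum]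
  refine Finset.sum_congr rfl fun i _ => ?_
  rw [← add_smul]
  congr 1
  ring

lemma BB_hsymZ (N : ℕ) (p q : ℤ) (hp : p + 1 ≤ N) (hq : q + 1 ≤ N) :
    BB N (hsymZ p) (hsymZ (q + 1)) - BB N (hsymZ (p + 1)) (hsymZ q) =
      ((p : ℂ) + 1) • (hsymZ (p + 1) * hsymZ q) - ((q : ℂ) + 1) • (hsymZ p * hsymZ (q + 1)) := by
  let F : ℕ → ℕ → MvPolynomial ℕ+ ℂ := fun i j => TT (i + j) * (hsymZ (p - i) * hsymZ (q - j))
  have e1 : BB N (hsymZ p) (hsymZ (q + 1)) + ((q : ℂ) + 1) • (hsymZ p * hsymZ (q + 1))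
      = ∑ i ∈ Finset.range N, ∑ j ∈ Finset.range N, F i j := by
    have h := hsymZ_rec (q + 1) N hq
    push_cast at h
    rw [← mul_smul_comm, h]
    have hN : ∀ j ∈ Finset.range N, F N j = 0 := fun j _ => by
      simp only [F]; rw [hsymZ_neg (k := p - N) (by omega)]; ring
    have : ∑ i ∈ Finset.range N, ∑ j ∈ Finset.range N, F i j =
        ∑ i ∈ Finset.range (N + 1), ∑ j ∈ Finset.range N, F i j := by
      rw [Finset.sum_range_succ, Finset.sum_eq_zero hN, add_zero]
    rw [this, Finset.sum_range_succ']
    refine congrArg₂ (· + ·) ?_ ?_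
    · unfold BB
      refine Finset.sum_congr rfl fun i _ => Finset.sum_congr rfl fun j _ => ?_
      rw [DD_hsymZ, DD_hsymZ]
      simp only [F]
      rw [show i + 1 + j = i + j + 1 by ring, show q + 1 - ((j : ℤ) + 1) = q - j by ring]
      push_cast
      rfl
    · rw [Finset.mul_sum]
      refine Finset.sum_congr rfl fun j _ => ?_
      simp only [F]
      rw [show q + 1 - ((j : ℤ) + 1) = q - j by ring]
      simp
      ring
  have e2 : BB N (hsymZ (p + 1)) (hsymZ q) + ((p : ℂ) + 1) • (hsymZ (p + 1) * hsymZ q)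
      = ∑ i ∈ Finset.range N, ∑ j ∈ Finset.range N, F i j := by
    have h := hsymZ_rec (p + 1) N hp
    push_cast at h
    rw [← smul_mul_assoc, h, Finset.sum_mul]
    unfold BB
    rw [← Finset.sum_add_distrib]
    refine Finset.sum_congr rfl fun i _ => ?_
    have hN : F i N = 0 := by
      simp only [F]; rw [hsymZ_neg (k := q - N) (by omega)]; ring
    have : ∑ j ∈ Finset.range N, F i j = ∑ j ∈ Finset.range (N + 1), F i j := by
      rw [Finset.sum_range_succ, hN, add_zero]
    rw [this, Finset.sum_range_succ']
    refine congrArg₂ (· + ·) ?_ ?_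
    · refine Finset.sum_congr rfl fun j _ => ?_
      rw [DD_hsymZ, DD_hsymZ]
      simp only [F]
      rw [show p + 1 - ((i : ℤ) + 1) = p - i by ring]
      push_cast
      rfl
    · simp only [F]
      rw [show p + 1 - ((i : ℤ) + 1) = p - i by ring]
      simp
      ring
  linear_combination e1 - e2

noncomputable def Phi {n : ℕ} (l : Fin n → ℤ) : MvPolynomial (Fin n) ℂ →ₗ[ℂ] MvPolynomial ℕ+ ℂ :=
  (basisMonomials (Fin n) ℂ).constr ℂ (fun m => ∏ a, hsymZ (l a + m a))

lemma Phi_monomial {n : ℕ} (l : Fin n → ℤ) (m : Fin n →₀ ℕ) (c : ℂ) :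
    Phi l (monomial m c) = c • ∏ a, hsymZ (l a + m a) := by
  have : monomial m c = c • basisMonomials (Fin n) ℂ m := by
    simp [coe_basisMonomials, smul_monomial]
  rw [this, map_smul, Phi, Module.Basis.constr_basis]

noncomputable def Psi {n : ℕ} (l : Fin n → ℤ) (N : ℕ) (p : Fin n × Fin n) :
    MvPolynomial (Fin n) ℂ →ₗ[ℂ] MvPolynomial ℕ+ ℂ :=
  (basisMonomials (Fin n) ℂ).constr ℂ (fun m =>
    (∏ c ∈ (Finset.univ.erase p.2).erase p.1, hsymZ (l c + m c)) *
      BB N (hsymZ (l p.1 + m p.1)) (hsymZ (l p.2 + m p.2)))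

lemma Psi_monomial {n : ℕ} (l : Fin n → ℤ) (N : ℕ) (p : Fin n × Fin n) (m : Fin n →₀ ℕ) (c : ℂ) :
    Psi l N p (monomial m c) = c • ((∏ c ∈ (Finset.univ.erase p.2).erase p.1, hsymZ (l c + m c)) *
      BB N (hsymZ (l p.1 + m p.1)) (hsymZ (l p.2 + m p.2))) := by
  have : monomial m c = c • basisMonomials (Fin n) ℂ m := by
    simp [coe_basisMonomials, smul_monomial]
  rw [this, map_smul, Psi, Module.Basis.constr_basis]

noncomputable def th {n : ℕ} (a : Fin n) : Derivation ℂ (MvPolynomial (Fin n) ℂ) (MvPolynomial (Fin n) ℂ) :=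
  (X a : MvPolynomial (Fin n) ℂ) • pderiv a

lemma th_monomial {n : ℕ} (a : Fin n) (m : Fin n →₀ ℕ) (c : ℂ) :
    th a (monomial m c) = (m a : ℂ) • monomial m c := by
  rw [th, Derivation.smul_apply, smul_eq_mul, X_mul_pderiv_monomial, Nat.cast_smul_eq_nsmul]

noncomputable def NN {n : ℕ} (l : Fin n → ℤ) (a : Fin n) :
    MvPolynomial (Fin n) ℂ →ₗ[ℂ] MvPolynomial (Fin n) ℂ :=
  (l a : ℂ) • LinearMap.id + (th a).toLinearMap

lemma NN_monomial {n : ℕ} (l : Fin n → ℤ) (a : Fin n) (m : Fin n →₀ ℕ) (c : ℂ) :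
    NN l a (monomial m c) = ((l a : ℂ) + m a) • monomial m c := by
  have : NN l a (monomial m c) = (l a : ℂ) • monomial m c + th a (monomial m c) := rfl
  rw [this, th_monomial, add_smul]

lemma Psi_rel {n : ℕ} (l : Fin n → ℤ) (p : Fin n × Fin n) (hp : p.1 ≠ p.2)
    (f : MvPolynomial (Fin n) ℂ) : ∀ᶠ N in Filter.atTop,
    Psi l N p ((X p.2 - X p.1) * f) = Phi l (NN l p.1 (X p.1 * f) - NN l p.2 (X p.2 * f)) := by
  induction f using MvPolynomial.induction_on' with
  | monomial m c =>
    filter_upwards [Filter.eventually_ge_atTop (l p.1 + m p.1 + 1).toNat,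
      Filter.eventually_ge_atTop (l p.2 + m p.2 + 1).toNat] with N h1 h2
    obtain ⟨a, b⟩ := p
    simp only at *
    have hX : ∀ a : Fin n, X a * monomial m c = monomial (Finsupp.single a 1 + m) c := fun a => by
      rw [X, monomial_mul, one_mul]
    have hprod : ∀ g : Fin n → MvPolynomial ℕ+ ℂ,
        ∏ c, g c = g a * g b * ∏ c ∈ (Finset.univ.erase b).erase a, g c := fun g => by
      rw [← Finset.mul_prod_erase Finset.univ g (Finset.mem_univ b),
        ← Finset.mul_prod_erase (Finset.univ.erase b) g (a := a) (by simp [hp])]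
      ring
    have hR : ∀ d : Fin n, (d = a ∨ d = b) → ∏ c ∈ (Finset.univ.erase b).erase a,
        hsymZ (l c + ((Finsupp.single d 1 + m : Fin n →₀ ℕ) c : ℕ)) =
        ∏ c ∈ (Finset.univ.erase b).erase a, hsymZ (l c + m c) := by
      intro d hd
      refine Finset.prod_congr rfl fun c hc => ?_
      simp only [Finset.mem_erase, Finset.mem_univ, and_true] at hc
      have : d ≠ c := by rintro rfl; tauto
      simp [this]
    rw [sub_mul, hX, hX, map_sub, map_sub, Psi_monomial, Psi_monomial, NN_monomial, NN_monomial,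
      map_smul, map_smul, Phi_monomial, Phi_monomial, hprod, hprod]
    simp only
    rw [hR a (Or.inl rfl), hR b (Or.inr rfl)]
    have key := BB_hsymZ N (l a + m a) (l b + m b) (by omega) (by omega)
    simp only [Finsupp.add_apply, Finsupp.single_eq_same, Finsupp.single_eq_of_ne hp,
      Finsupp.single_eq_of_ne hp.symm, zero_add, Nat.cast_add, Nat.cast_one]
    rw [show l a + (1 + (m a : ℤ)) = l a + m a + 1 by ring,
      show l b + (1 + (m b : ℤ)) = l b + m b + 1 by ring,
      show (l a : ℂ) + (1 + (m a : ℂ)) = l a + m a + 1 by ring,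
      show (l b : ℂ) + (1 + (m b : ℂ)) = l b + m b + 1 by ring]
    push_cast at key
    rw [← smul_sub, ← mul_sub, key]
    simp only [smul_eq_C_mul]
    ring
  | add f g hf hg =>
    filter_upwards [hf, hg] with N hf hg
    rw [mul_add, map_add, hf, hg, mul_add, mul_add, map_add, map_add, ← map_add,
      add_sub_add_comm]

def PP (n : ℕ) : Finset (Fin n × Fin n) := Finset.univ.filter fun p => p.1 < p.2

lemma sum_symm {n : ℕ} {M : Type*} [AddCommMonoid M] (G : Fin n → Fin n → M)
    (hG : ∀ a b, G a b = G b a) :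
    ∑ a, ∑ b ∈ Finset.univ.erase a, G b a = 2 • ∑ p ∈ PP n, G p.1 p.2 := by
  have h1 : ∀ a : Fin n, ∑ b ∈ Finset.univ.erase a, G b a =
      ∑ b, (if b < a then G b a else 0) + ∑ b, (if a < b then G a b else 0) := by
    intro a
    rw [← Finset.sum_filter, ← Finset.sum_filter, ← Finset.sum_congr rfl (fun b _ => hG b a),
      ← Finset.sum_union]
    · refine Finset.sum_congr ?_ fun _ _ => rfl
      ext b
      simp only [Finset.mem_erase, Finset.mem_univ, and_true, Finset.mem_union,
        Finset.mem_filter, true_and]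
      exact ne_iff_lt_or_gt
    · rw [Finset.disjoint_filter]
      intro b _ h1 h2
      exact absurd h1 (not_lt.2 h2.le)
  have h2 : ∑ p ∈ PP n, G p.1 p.2 = ∑ a, ∑ b, (if a < b then G a b else 0) := by
    rw [PP, Finset.sum_filter, ← Finset.univ_product_univ, Finset.sum_product]
  rw [Finset.sum_congr rfl fun a _ => h1 a, Finset.sum_add_distrib, Finset.sum_comm, ← h2, two_nsmul]

lemma Phi_cut {n : ℕ} (l : Fin n → ℤ) (f : MvPolynomial (Fin n) ℂ) : ∀ᶠ N in Filter.atTop,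
    cutN N (Phi l f) = Phi l (∑ a, (NN l a (NN l a f) - NN l a f)) +
      2 • ∑ p ∈ PP n, Psi l N p f := by
  induction f using MvPolynomial.induction_on' with
  | monomial m c =>
    have hN : ∀ᶠ N : ℕ in Filter.atTop, ∀ a, l a + m a ≤ N := by
      rw [Filter.eventually_all]
      intro a
      filter_upwards [Filter.eventually_ge_atTop (l a + m a).toNat] with N h
      omega
    filter_upwards [hN] with N hN
    rw [Phi_monomial, cutN_smul, cutN_prod]
    have hs := sum_symm (fun b a => (∏ c ∈ (Finset.univ.erase a).erase b, hsymZ (l c + m c)) *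
      BB N (hsymZ (l b + m b)) (hsymZ (l a + m a))) (fun a b => by
        rw [BB_symm, Finset.erase_right_comm])
    rw [hs, smul_add, smul_comm c (2 : ℕ), Finset.smul_sum, Finset.smul_sum]
    simp only [Psi_monomial]
    refine congrArg₂ (· + ·) ?_ rfl
    rw [map_sum]
    refine Finset.sum_congr rfl fun a _ => ?_
    rw [cutN_hsymZ N _ (hN a), mul_smul_comm, Finset.prod_erase_mul _ _ (Finset.mem_univ a),
      map_sub, NN_monomial, map_smul, map_smul, NN_monomial, map_smul, Phi_monomial]
    simp only [smul_eq_C_mul]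
    push_cast
    simp only [C_mul, C_add, C_sub, C_1]
    ring
  | add f g hf hg =>
    filter_upwards [hf, hg] with N hf hg
    rw [map_add, cutN_add, hf, hg]
    simp only [map_add, map_sum, map_sub, Finset.sum_add_distrib, Finset.sum_sub_distrib, smul_add]
    abel

noncomputable def VV (n : ℕ) : MvPolynomial (Fin n) ℂ := (Matrix.vandermonde X).det

lemma VV_eq_prod (n : ℕ) : VV n = ∏ p ∈ PP n, (X p.2 - X p.1) := by
  rw [VV, Matrix.det_vandermonde, PP, Finset.prod_filter, ← Finset.univ_product_univ,
    Finset.prod_product]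
  refine Finset.prod_congr rfl fun i _ => ?_
  rw [← Finset.prod_filter]
  refine Finset.prod_congr ?_ fun _ _ => rfl
  ext j; simp

lemma VV_eq_sum (n : ℕ) : VV n = ∑ σ : Equiv.Perm (Fin n), (Equiv.Perm.sign σ : ℤ) •
    monomial (Finsupp.equivFunOnFinite.symm fun i => ((σ i : Fin n) : ℕ)) (1 : ℂ) := by
  rw [VV, ← Matrix.det_transpose, Matrix.det_apply]
  refine Finset.sum_congr rfl fun σ _ => ?_
  rw [Units.smul_def]
  congr 1
  rw [monomial_eq, C_1, one_mul, Finsupp.prod_fintype _ _ (by simp)]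
  simp [Matrix.vandermonde_apply]

noncomputable def ff (n : ℕ) (p : Fin n × Fin n) : MvPolynomial (Fin n) ℂ :=
  ∏ q ∈ (PP n).erase p, (X q.2 - X q.1)

lemma VV_eq_ff {n : ℕ} (p : Fin n × Fin n) (hp : p ∈ PP n) : VV n = (X p.2 - X p.1) * ff n p := by
  rw [VV_eq_prod, ff, Finset.mul_prod_erase (PP n) (fun q => X q.2 - X q.1) hp]

lemma sum_NN_th {n : ℕ} (l : Fin n → ℤ) : ∑ a, NN l a (th a (VV n)) =
    ∑ p ∈ PP n, (NN l p.2 (X p.2 * ff n p) - NN l p.1 (X p.1 * ff n p)) := by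
  have h : ∀ a, NN l a (th a (VV n)) = ∑ p ∈ PP n,
      ((if p.2 = a then NN l a (X a * ff n p) else 0) -
        (if p.1 = a then NN l a (X a * ff n p) else 0)) := by
    intro a
    rw [VV_eq_prod, derivation_prod, map_sum]
    refine Finset.sum_congr rfl fun p _ => ?_
    have hx : ∀ b, th a (X b) = if b = a then X a else 0 := by
      intro b
      by_cases hb : b = a
      · subst hb; simp [th]
      · simp [th, hb, pderiv_X_of_ne hb]
    rw [map_sub, hx, hx, mul_sub, map_sub]
    change NN l a (ff n p * _) - NN l a (ff n p * _) = _
    split_ifs <;> simp [mul_comm]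
  rw [Finset.sum_congr rfl fun a _ => h a, Finset.sum_comm]
  refine Finset.sum_congr rfl fun p _ => ?_
  rw [Finset.sum_sub_distrib, Finset.sum_ite_eq, Finset.sum_ite_eq]
  simp

lemma eig_VV {n : ℕ} (l : Fin n → ℤ) :
    ∑ a, (NN l a (NN l a (VV n)) - NN l a (VV n)) - 2 • ∑ a, NN l a (th a (VV n)) =
      (∑ a : Fin n, ((l a : ℂ) ^ 2 - l a - (a : ℕ) ^ 2 - (a : ℕ))) • VV n := by
  rw [Finset.smul_sum, ← Finset.sum_sub_distrib]
  conv_lhs => rw [VV_eq_sum]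
  conv_rhs => rw [VV_eq_sum]
  simp only [map_sum, map_zsmul, ← Finset.sum_sub_distrib, Finset.smul_sum]
  rw [Finset.sum_comm]
  refine Finset.sum_congr rfl fun σ _ => ?_
  set m : Fin n →₀ ℕ := Finsupp.equivFunOnFinite.symm fun i => ((σ i : Fin n) : ℕ) with hm
  have hma : ∀ a, m a = ((σ a : Fin n) : ℕ) := fun a => rfl
  have hsum : ∑ a : Fin n, ((l a : ℂ) ^ 2 - l a - (a : ℕ) ^ 2 - (a : ℕ)) =
      ∑ a : Fin n, ((l a : ℂ) ^ 2 - l a - (m a : ℕ) ^ 2 - (m a : ℕ)) := by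
    simp only [sub_sub (_ - _ : ℂ), Finset.sum_sub_distrib (f := fun a : Fin n => (l a : ℂ) ^ 2 - l a)]
    congr 1
    simp only [hma]
    exact (Equiv.sum_comp σ (fun a : Fin n => (((a : ℕ) : ℂ) ^ 2 + (a : ℕ)))).symm
  rw [hsum, Finset.sum_smul]
  refine Finset.sum_congr rfl fun a _ => ?_
  simp only [th_monomial, NN_monomial, map_smul]
  simp only [smul_eq_C_mul, zsmul_eq_mul, nsmul_eq_mul,
    C_sub, C_add, C_pow, map_natCast]
  push_cast
  ring

lemma schur_eq (lam : Ptn) :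
    schur lam = Phi (fun a : Fin lam.len => (lam.parts a : ℤ) - (a : ℕ)) (VV lam.len) := by
  rw [VV_eq_sum, schur, ← Matrix.det_transpose, Matrix.det_apply, map_sum]
  refine Finset.sum_congr rfl fun σ _ => ?_
  rw [Units.smul_def, map_zsmul, Phi_monomial, one_smul]
  congr 1
  refine Finset.prod_congr rfl fun a _ => ?_
  simp only [Matrix.transpose_apply, Matrix.of_apply, Finsupp.equivFunOnFinite_symm_apply_apply]
  congr 1
  ring

/-- Every Schur polynomial is an eigenvector of the cut-and-join operator, with
eigenvalue the sum `Σ_{(i,j)∈λ} (j−i)` of the contents of the cells of `λ`. -/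
theorem statement12 (lam : Ptn) :
    cutJoin (schur lam) =
      (((∑ i ∈ Finset.range lam.len, ∑ j ∈ Finset.range (lam.parts i),
        (((j : ℤ) + 1) - ((i : ℤ) + 1))) : ℤ) : ℂ) • schur lam := by
  set n := lam.len with hn
  set l : Fin n → ℤ := fun a => (lam.parts a : ℤ) - (a : ℕ) with hl
  have hs : schur lam = Phi l (VV n) := schur_eq lam
  have e1 := cutJoin_eventually (schur lam)
  have e2 := Phi_cut l (VV n)
  have e3 : ∀ᶠ N : ℕ in Filter.atTop, ∀ p : PP n,
      Psi l N p.1 ((X p.1.2 - X p.1.1) * ff n p.1) =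
        Phi l (NN l p.1.1 (X p.1.1 * ff n p.1) - NN l p.1.2 (X p.1.2 * ff n p.1)) := by
    rw [Filter.eventually_all]
    intro p
    apply Psi_rel
    have := p.2
    simp only [PP, Finset.mem_filter] at this
    exact this.2.ne
  obtain ⟨N, h1, h2, h3⟩ := (e1.and (e2.and e3)).exists
  have h4 : ∑ p ∈ PP n, Psi l N p (VV n) = - Phi l (∑ a, NN l a (th a (VV n))) := by
    rw [sum_NN_th, map_sum, ← Finset.sum_neg_distrib]
    refine Finset.sum_congr rfl fun p hp => ?_
    conv_lhs => rw [VV_eq_ff p hp]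
    rw [h3 ⟨p, hp⟩, ← map_neg, neg_sub]
  have h5 : cutN N (Phi l (VV n)) =
      (∑ a : Fin n, ((l a : ℂ) ^ 2 - l a - (a : ℕ) ^ 2 - (a : ℕ))) • Phi l (VV n) := by
    rw [h2, h4, ← map_smul, ← eig_VV, map_sub, map_nsmul, smul_neg, sub_eq_add_neg]
  rw [h1, hs, h5, smul_smul]
  congr 1
  push_cast
  rw [Finset.mul_sum, Finset.sum_range]
  refine Finset.sum_congr rfl fun a _ => ?_
  have : ∀ k : ℕ, ∑ j ∈ Finset.range k, ((j : ℂ) + 1 - ((a : ℕ) + 1)) =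
      2⁻¹ * ((k : ℂ) ^ 2 - k) - (a : ℕ) * k := by
    intro k
    induction k with
    | zero => simp
    | succ k ih => rw [Finset.sum_range_succ, ih]; push_cast; ring
  rw [this]
  simp only [hl]
  push_cast
  ring
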